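/- arXiv:2603.24395 — 2 statements merged into one kernel-verified Lean document; each statement's English description precedes it below -/
import Mathlib

section
/- Let R > 0 and let k ∈ ℤ³. Then Σ_{h ∈ ℤ³, ‖h‖ ≤ R, ‖h+k‖ > R} k·(2h + k) = ‖k‖² · #{h ∈ ℤ³ : ‖h‖ ≤ R}, where ‖·‖ is the Euclidean norm of the corresponding vector in ℝ³ and · is the Euclidean inner product. -/
/-- Euclidean norm of a lattice point of `ℤ³`, viewed in `ℝ³`. -/
noncomputable def latNorm (h : Fin 3 → ℤ) : ℝ := Real.sqrt (∑ i, ((h i : ℝ)) ^ 2)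

/-- Euclidean inner product of two lattice points of `ℤ³`. -/
def latDot (k h : Fin 3 → ℤ) : ℤ := ∑ i, k i * h i

theorem latNorm_neg (h : Fin 3 → ℤ) : latNorm (-h) = latNorm h := by
  simp [latNorm]

theorem latDot_neg_right (k h : Fin 3 → ℤ) : latDot k (-h) = -latDot k h := by
  simp [latDot]

theorem latDot_add_right (k h l : Fin 3 → ℤ) : latDot k (h + l) = latDot k h + latDot k l := by
  simp [latDot, mul_add, Finset.sum_add_distrib]

theorem abs_apply_le_latNorm (h : Fin 3 → ℤ) (i : Fin 3) : |(h i : ℝ)| ≤ latNorm h :=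
  Real.abs_le_sqrt
    (Finset.single_le_sum (f := fun j => (h j : ℝ) ^ 2) (fun _ _ => sq_nonneg _)
      (Finset.mem_univ i))

theorem finite_latNorm_le (R : ℝ) : {h : Fin 3 → ℤ | latNorm h ≤ R}.Finite := by
  refine (Set.finite_Icc (fun _ : Fin 3 => -⌊R⌋) (fun _ => ⌊R⌋)).subset fun h hh => ?_
  have key (i : Fin 3) : |h i| ≤ ⌊R⌋ :=
    Int.le_floor.2 (by push_cast; exact (abs_apply_le_latNorm h i).trans hh)
  exact ⟨fun i => (abs_le.1 (key i)).1, fun i => (abs_le.1 (key i)).2⟩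

/-- A sum over a finite set vanishes if an involution of the set flips the sign of the summand. -/
theorem Finset.sum_eq_zero_of_involution_neg {α : Type*} (s : Finset α) (f : α → ℤ) (σ : α → α)
    (hσ : Function.Involutive σ) (hs : ∀ a ∈ s, σ a ∈ s) (hf : ∀ a, f (σ a) = -f a) :
    ∑ a ∈ s, f a = 0 := by
  have h : ∑ a ∈ s, f a = ∑ a ∈ s, -f a :=
    Finset.sum_bij' (fun a _ => σ a) (fun a _ => σ a) hs hs (fun a _ => hσ a) (fun a _ => hσ a)
      fun a _ => by rw [hf, neg_neg]
  rw [Finset.sum_neg_distrib] at h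
  linarith

theorem stmt_10 (R : ℝ) (hR : 0 < R) (k : Fin 3 → ℤ) :
    ∑ᶠ h ∈ {h : Fin 3 → ℤ | latNorm h ≤ R ∧ R < latNorm (h + k)}, latDot k (2 • h + k) =
      latDot k k * Nat.card {h : Fin 3 → ℤ // latNorm h ≤ R} := by
  classical
  set B := (finite_latNorm_le R).toFinset with hB
  have mem_B (h : Fin 3 → ℤ) : h ∈ B ↔ latNorm h ≤ R := by simp [hB]
  have shell : {h : Fin 3 → ℤ | latNorm h ≤ R ∧ R < latNorm (h + k)} =
      ↑(B.filter fun h => ¬ latNorm (h + k) ≤ R) := by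
    ext h
    simp [mem_B]
  have card_B : Nat.card {h : Fin 3 → ℤ // latNorm h ≤ R} = B.card :=
    Nat.subtype_card B mem_B
  have lens : ∑ h ∈ B.filter (fun h => latNorm (h + k) ≤ R), latDot k (2 • h + k) = 0 := by
    refine Finset.sum_eq_zero_of_involution_neg _ _ (fun h => -(h + k)) (fun h => by simp)
      (fun h hh => ?_) fun h => ?_
    · rw [Finset.mem_filter, mem_B] at hh ⊢
      have : -(h + k) + k = -h := by abel
      rw [this, latNorm_neg, latNorm_neg]
      exact hh.symm
    · rw [← latDot_neg_right]
      congr 1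
      abel
  have ball : ∑ h ∈ B, latDot k (2 • h) = 0 := by
    refine Finset.sum_eq_zero_of_involution_neg _ _ (fun h => -h) neg_neg
      (fun h hh => ?_) fun h => ?_
    · rwa [mem_B, latNorm_neg, ← mem_B]
    · rw [smul_neg, latDot_neg_right]
  have split := Finset.sum_filter_add_sum_filter_not B (fun h => latNorm (h + k) ≤ R)
    fun h => latDot k (2 • h + k)
  rw [lens, zero_add] at split
  rw [shell, finsum_mem_coe_finset, split, card_B]
  simp_rw [latDot_add_right k (2 • _) k]
  rw [Finset.sum_add_distrib, ball, zero_add, Finset.sum_const, nsmul_eq_mul, mul_comm]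
end

section
/- Let k ∈ ℤ³ with k ≠ 0 and let R be a real number with R ≥ ‖k‖ + √3. Then #{h ∈ ℤ³ : ‖h‖ ≤ R and ‖h + k‖ > R} ≤ 4π·(R + √3)²·(‖k‖ + 2√3), where ‖·‖ is the Euclidean norm of the corresponding vector in ℝ³. -/
open MeasureTheory

/-- The half-open unit cube of `ℝⁿ` with lowest corner `h`. -/
def unitCube {ι : Type*} (h : ι → ℤ) : Set (EuclideanSpace ℝ ι) :=
  {x | ∀ i, ⌊x i⌋ = h i}

theorem unitCube_eq_preimage {ι : Type*} (h : ι → ℤ) :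
    unitCube h = (WithLp.ofLp : EuclideanSpace ℝ ι → ι → ℝ) ⁻¹'
      Set.univ.pi fun i => Set.Ico (h i : ℝ) (h i + 1) := by
  ext x
  simp [unitCube, Int.floor_eq_iff]

theorem pairwise_disjoint_unitCube {ι : Type*} :
    Pairwise (Function.onFun Disjoint (unitCube (ι := ι))) := by
  intro g h hgh
  refine Set.disjoint_left.2 fun x hg hh => hgh ?_
  funext i
  exact (hg i).symm.trans (hh i)

theorem measurableSet_unitCube {ι : Type*} [Fintype ι] (h : ι → ℤ) :
    MeasurableSet (unitCube h) := by
  rw [unitCube_eq_preimage]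
  exact (MeasurableSet.univ_pi fun _ => measurableSet_Ico).preimage
    (PiLp.volume_preserving_ofLp ι).measurable

theorem volume_unitCube {ι : Type*} [Fintype ι] (h : ι → ℤ) :
    volume (unitCube h) = 1 := by
  rw [unitCube_eq_preimage, (PiLp.volume_preserving_ofLp ι).measure_preimage
    (MeasurableSet.univ_pi fun _ => measurableSet_Ico).nullMeasurableSet]
  simp [volume_pi_pi]

/-- A set of measure at most `c` contains at most `c` unit lattice cubes. -/
theorem natCard_le_of_unitCube_subset {ι : Type*} [Fintype ι] {p : (ι → ℤ) → Prop}
    {S : Set (EuclideanSpace ℝ ι)} (hS : ∀ h, p h → unitCube h ⊆ S) {c : ℝ} (hc : 0 ≤ c)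
    (hvol : volume S ≤ ENNReal.ofReal c) :
    (Nat.card {h // p h} : ℝ) ≤ c := by
  cases finite_or_infinite {h // p h} with
  | inr _ => simpa using hc
  | inl _ =>
    have := Fintype.ofFinite {h // p h}
    have hsum : volume (⋃ h : {h // p h}, unitCube h.1) = Nat.card {h // p h} := by
      rw [measure_iUnion (pairwise_disjoint_unitCube.comp_of_injective Subtype.val_injective)
        fun h : {h // p h} => measurableSet_unitCube h.1]
      simp [volume_unitCube]
    have hle := (measure_mono (Set.iUnion_subset fun h : {h // p h} => hS h.1 h.2)).trans hvol
    rw [hsum] at hle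
    simpa [ENNReal.toReal_ofReal hc] using ENNReal.toReal_mono ENNReal.ofReal_ne_top hle

/-- The embedding of `ℤ³` into `ℝ³`. -/
def latVec (h : Fin 3 → ℤ) : EuclideanSpace ℝ (Fin 3) := WithLp.toLp 2 fun i => (h i : ℝ)

theorem norm_latVec (h : Fin 3 → ℤ) : ‖latVec h‖ = latNorm h := by
  simp [latVec, latNorm, EuclideanSpace.norm_eq]

theorem latNorm_add_le (g h : Fin 3 → ℤ) : latNorm (g + h) ≤ latNorm g + latNorm h := by
  have hadd : latVec (g + h) = latVec g + latVec h := by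
    ext i
    simp [latVec]
  simpa only [← norm_latVec, hadd] using norm_add_le (latVec g) (latVec h)

theorem norm_sub_latVec_le {h : Fin 3 → ℤ} {x : EuclideanSpace ℝ (Fin 3)}
    (hx : x ∈ unitCube h) : ‖x - latVec h‖ ≤ √3 := by
  rw [EuclideanSpace.norm_eq]
  apply Real.sqrt_le_sqrt
  calc ∑ i, ‖(x - latVec h) i‖ ^ 2 ≤ ∑ _i : Fin 3, (1 : ℝ) := by
        refine Finset.sum_le_sum fun i _ => ?_
        have hxi := Int.floor_eq_iff.1 (hx i)
        rw [Real.norm_eq_abs, sq_abs]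
        simp only [latVec, PiLp.sub_apply]
        nlinarith
    _ = 3 := by simp

theorem volume_closedBall_diff_ball_le {a b : ℝ} (ha : 0 ≤ a) (hab : a ≤ b) :
    volume (Metric.closedBall (0 : EuclideanSpace ℝ (Fin 3)) b \ Metric.ball 0 a) ≤
      ENNReal.ofReal (4 * Real.pi * b ^ 2 * (b - a)) := by
  have hb := ha.trans hab
  have hsub : Metric.ball (0 : EuclideanSpace ℝ (Fin 3)) a ⊆ Metric.closedBall 0 b :=
    Metric.ball_subset_closedBall.trans (Metric.closedBall_subset_closedBall hab)
  rw [measure_sdiff hsub measurableSet_ball.nullMeasurableSet measure_ball_lt_top.ne,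
    EuclideanSpace.volume_closedBall_fin_three, EuclideanSpace.volume_ball_fin_three,
    ← ENNReal.ofReal_pow hb, ← ENNReal.ofReal_pow ha, ← ENNReal.ofReal_mul (by positivity),
    ← ENNReal.ofReal_mul (by positivity), ← ENNReal.ofReal_sub _ (by positivity)]
  apply ENNReal.ofReal_le_ofReal
  have hcube : b ^ 3 - a ^ 3 ≤ 3 * (b ^ 2 * (b - a)) := by
    have := mul_nonneg (mul_nonneg (sub_nonneg.2 hab) (sub_nonneg.2 hab))
      (by positivity : 0 ≤ 2 * b + a)
    linarith
  have := mul_le_mul_of_nonneg_left hcube (by positivity : 0 ≤ Real.pi * 4 / 3)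
  linarith

theorem stmt_15 (k : Fin 3 → ℤ) (hk : k ≠ 0) (R : ℝ)
    (hR : latNorm k + Real.sqrt 3 ≤ R) :
    (Nat.card {h : Fin 3 → ℤ // latNorm h ≤ R ∧ R < latNorm (h + k)} : ℝ) ≤
      4 * Real.pi * (R + Real.sqrt 3) ^ 2 * (latNorm k + 2 * Real.sqrt 3) := by
  have hk0 : 0 ≤ latNorm k := Real.sqrt_nonneg _
  have h3 : 0 ≤ √3 := Real.sqrt_nonneg 3
  refine natCard_le_of_unitCube_subset
    (S := Metric.closedBall 0 (R + √3) \ Metric.ball 0 (R - √3 - latNorm k)) ?_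
    (by positivity) ?_
  · rintro h ⟨hin, hout⟩ x hx
    have hdist := norm_sub_latVec_le hx
    have htri := latNorm_add_le h k
    have hupper := norm_le_norm_add_norm_sub' x (latVec h)
    have hlower := norm_le_norm_add_norm_sub x (latVec h)
    rw [norm_latVec] at hupper hlower
    simp only [Set.mem_sdiff, Metric.mem_closedBall, Metric.mem_ball, dist_zero_right, not_lt]
    constructor <;> linarith
  · convert volume_closedBall_diff_ball_le (a := R - √3 - latNorm k) (b := R + √3)
      (by linarith) (by linarith) using 3
    ring
end
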